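/- Let k₁, k₂ ∈ ℝ and let H = (1/2)p₁²(1 + q₁²)³ + (1/2)p₂²(1 + q₂²)³ + k₁/q₁² + k₂/q₂² be the position-dependent-mass Smorodinsky–Winternitz Hamiltonian on the open set {q₁ ≠ 0, q₂ ≠ 0} ⊂ ℝ⁴. Define Q_i = q_i/√(1 + q_i²) and P_i = p_i(1 + q_i²)^{3/2} for i = 1, 2. Then (i) the transformation is canonical: {Q_i, P_j} = δ_{ij}, {Q₁,Q₂} = {P₁,P₂} = 0; and (ii) H is mapped to the unit-mass Smorodinsky–Winternitz Hamiltonian up to an additive constant: (1/2)P₁² + (1/2)P₂² + k₁/Q₁² + k₂/Q₂² = H(q₁,q₂,p₁,p₂) + (k₁ + k₂) identically on {q₁ ≠ 0, q₂ ≠ 0}. -/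

import Mathlib

/-- Canonical Poisson bracket on (an open subset of) ℝ⁴ with coordinates (q₁, q₂, p₁, p₂). -/
noncomputable def poissonBracket (F G : ℝ → ℝ → ℝ → ℝ → ℝ) (q₁ q₂ p₁ p₂ : ℝ) : ℝ :=
    deriv (fun x => F x q₂ p₁ p₂) q₁ * deriv (fun x => G q₁ q₂ x p₂) p₁
  + deriv (fun x => F q₁ x p₁ p₂) q₂ * deriv (fun x => G q₁ q₂ p₁ x) p₂
  - deriv (fun x => F q₁ q₂ x p₂) p₁ * deriv (fun x => G x q₂ p₁ p₂) q₁
  - deriv (fun x => F q₁ q₂ p₁ x) p₂ * deriv (fun x => G q₁ x p₁ p₂) q₂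

/-- `Q₁ = q₁/√(1+q₁²)` as a function on phase space. -/
noncomputable def Q1 : ℝ → ℝ → ℝ → ℝ → ℝ := fun q₁ _ _ _ => q₁ / Real.sqrt (1 + q₁^2)
/-- `Q₂ = q₂/√(1+q₂²)` as a function on phase space. -/
noncomputable def Q2 : ℝ → ℝ → ℝ → ℝ → ℝ := fun _ q₂ _ _ => q₂ / Real.sqrt (1 + q₂^2)
/-- `P₁ = p₁(1+q₁²)^{3/2}` as a function on phase space. -/
noncomputable def P1 : ℝ → ℝ → ℝ → ℝ → ℝ := fun q₁ _ p₁ _ => p₁ * (1 + q₁^2) ^ ((3 : ℝ)/2)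
/-- `P₂ = p₂(1+q₂²)^{3/2}` as a function on phase space. -/
noncomputable def P2 : ℝ → ℝ → ℝ → ℝ → ℝ := fun _ q₂ _ p₂ => p₂ * (1 + q₂^2) ^ ((3 : ℝ)/2)

theorem aux_rpow (q : ℝ) : (1 + q^2) ^ ((3 : ℝ)/2) = (Real.sqrt (1 + q^2))^3 := by
  have h : (0:ℝ) ≤ 1 + q^2 := by positivity
  rw [Real.sqrt_eq_rpow, ← Real.rpow_natCast _ 3, ← Real.rpow_mul h]
  norm_num

theorem aux_deriv (q : ℝ) :
    deriv (fun x : ℝ => x / Real.sqrt (1 + x^2)) q * (1 + q^2) ^ ((3 : ℝ)/2) = 1 := by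
  have h : (0:ℝ) < 1 + q^2 := by positivity
  have hs : 0 < Real.sqrt (1 + q^2) := Real.sqrt_pos.mpr h
  have hsq : Real.sqrt (1 + q^2) ^ 2 = 1 + q^2 := Real.sq_sqrt h.le
  have h1 : HasDerivAt (fun x : ℝ => 1 + x^2) (2 * q) q := by
    simpa using (hasDerivAt_pow 2 q).const_add 1
  have h2 := (hasDerivAt_id' q).fun_div (h1.sqrt h.ne') hs.ne'
  rw [h2.deriv, aux_rpow]
  generalize Real.sqrt (1 + q^2) = s at *
  field_simp
  linarith

theorem aux_P (q p : ℝ) : (p * (1 + q^2) ^ ((3 : ℝ)/2))^2 = p^2 * (1 + q^2)^3 := by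
  have h : (0:ℝ) ≤ 1 + q^2 := by positivity
  have hsq : Real.sqrt (1 + q^2) ^ 2 = 1 + q^2 := Real.sq_sqrt h
  rw [aux_rpow, mul_pow, ← pow_mul, mul_comm 3 2, pow_mul, hsq]

theorem aux_Q (k q : ℝ) (hq : q ≠ 0) : k / (q / Real.sqrt (1 + q^2))^2 = k / q^2 + k := by
  have h : (0:ℝ) ≤ 1 + q^2 := by positivity
  rw [div_pow, Real.sq_sqrt h]
  field_simp

/-- The transformation `Q_i = q_i/√(1+q_i²)`, `P_i = p_i(1+q_i²)^{3/2}` is canonical and maps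
the position-dependent-mass Smorodinsky–Winternitz Hamiltonian to the unit-mass one, up to
the additive constant `k₁ + k₂` (Proposition 5.1). -/
theorem pdm_SW_duality (k₁ k₂ : ℝ) :
    ∀ q₁ q₂ p₁ p₂ : ℝ, q₁ ≠ 0 → q₂ ≠ 0 →
      (poissonBracket Q1 P1 q₁ q₂ p₁ p₂ = 1 ∧
       poissonBracket Q2 P2 q₁ q₂ p₁ p₂ = 1 ∧
       poissonBracket Q1 P2 q₁ q₂ p₁ p₂ = 0 ∧
       poissonBracket Q2 P1 q₁ q₂ p₁ p₂ = 0 ∧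
       poissonBracket Q1 Q2 q₁ q₂ p₁ p₂ = 0 ∧
       poissonBracket P1 P2 q₁ q₂ p₁ p₂ = 0) ∧
      (1/2) * (P1 q₁ q₂ p₁ p₂)^2 + (1/2) * (P2 q₁ q₂ p₁ p₂)^2
        + k₁ / (Q1 q₁ q₂ p₁ p₂)^2 + k₂ / (Q2 q₁ q₂ p₁ p₂)^2
      = ((1/2) * p₁^2 * (1 + q₁^2)^3 + (1/2) * p₂^2 * (1 + q₂^2)^3
          + k₁ / q₁^2 + k₂ / q₂^2) + (k₁ + k₂) := by
  intro q₁ q₂ p₁ p₂ h₁ h₂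
  have d (c p : ℝ) : deriv (fun x : ℝ => x * c) p = c := by
    simp
  refine ⟨⟨?_, ?_, ?_, ?_, ?_, ?_⟩, ?_⟩
  · simp only [poissonBracket, Q1, P1, d, deriv_const, aux_deriv]; ring
  · simp only [poissonBracket, Q2, P2, d, deriv_const, aux_deriv]; ring
  · simp only [poissonBracket, Q1, P2, deriv_const]; ring
  · simp only [poissonBracket, Q2, P1, deriv_const]; ring
  · simp only [poissonBracket, Q1, Q2, deriv_const]; ring
  · simp only [poissonBracket, P1, P2, deriv_const]; ring
  · simp only [P1, P2, Q1, Q2, aux_P, aux_Q _ _ h₁, aux_Q _ _ h₂]; ring
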